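/- arXiv:2303.16174 — 3 statements merged into one kernel-verified Lean document; each statement's English description precedes it below -/
import Mathlib

section
/- Let Z be a topological space. The map Ψ : M(1,1) × Z → C([0,1], |Glob(Z)|) defined by Ψ(φ, z) = δ_z ∘ φ is continuous (with C([0,1], |Glob(Z)|) carrying the compact-open topology) and injective, and its image is the set P(Z) = { δ_z ∘ φ : z ∈ Z, φ ∈ M(1,1) }. Moreover the inverse map P(Z) → M(1,1) × Z is sequentially continuous: if a sequence (δ_{z_n} ∘ φ_n) converges to δ_z ∘ φ in the compact-open topology, then z_n → z in Z and φ_n → φ uniformly. -/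
open unitInterval

/-- The relation generating the globe `|Glob(Z)|` as a quotient of `(Z × [0,1]) ⊕ {0, 1}`:
`(z, 0) ∼ 0` and `(z, 1) ∼ 1` (the two states `0` and `1` being encoded by `false, true`). -/
inductive globRel (Z : Type*) :
    (Z × unitInterval) ⊕ Bool → (Z × unitInterval) ⊕ Bool → Prop
  | zero (z : Z) : globRel Z (Sum.inl (z, 0)) (Sum.inr false)
  | one (z : Z) : globRel Z (Sum.inl (z, 1)) (Sum.inr true)

/-- The underlying space `|Glob(Z)|` of the globe of `Z`, with the quotient topology. -/
def Glob (Z : Type*) [TopologicalSpace Z] : Type _ := Quot (globRel Z)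

instance (Z : Type*) [TopologicalSpace Z] : TopologicalSpace (Glob Z) :=
  inferInstanceAs (TopologicalSpace (Quot (globRel Z)))

/-- The continuous path `δ_z : [0,1] → |Glob(Z)|`, `t ↦ [(z, t)]`. -/
def globDelta {Z : Type*} [TopologicalSpace Z] (z : Z) : C(unitInterval, Glob Z) :=
  ⟨fun t => Quot.mk _ (Sum.inl (z, t)),
    continuous_quot_mk.comp (continuous_inl.comp (Continuous.prodMk_right z))⟩

/-- `M(1,1)` : the space of continuous nondecreasing surjective maps `[0,1] → [0,1]`. -/
def M11 : Type := {φ : C(unitInterval, unitInterval) // Monotone φ ∧ Function.Surjective φ}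

instance : TopologicalSpace M11 :=
  inferInstanceAs (TopologicalSpace
    {φ : C(unitInterval, unitInterval) // Monotone φ ∧ Function.Surjective φ})

/-- The map `Ψ : M(1,1) × Z → C([0,1], |Glob(Z)|)`, `Ψ(φ, z) = δ_z ∘ φ`. -/
def globPsi {Z : Type*} [TopologicalSpace Z] (q : M11 × Z) : C(unitInterval, Glob Z) :=
  (globDelta q.2).comp q.1.1

/-- The set `P(Z) = { δ_z ∘ φ : z ∈ Z, φ ∈ M(1,1) }` of execution paths of the globe. -/
def globPaths (Z : Type*) [TopologicalSpace Z] : Set C(unitInterval, Glob Z) :=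
  {γ | ∃ (z : Z) (φ : C(unitInterval, unitInterval)),
    Monotone φ ∧ Function.Surjective φ ∧ γ = (globDelta z).comp φ}

/-- The projection `|Glob(Z)| → [0,1]`, `[(z, t)] ↦ t`. -/
def globHeight (Z : Type*) [TopologicalSpace Z] : C(Glob Z, unitInterval) where
  toFun := Quot.lift (Sum.elim (fun p => p.2) (fun b => cond b 1 0)) (by rintro _ _ (z | z) <;> rfl)
  continuous_toFun := continuous_quot_lift _
    (continuous_snd.sumElim continuous_of_discreteTopology)

/-- The part of the globe lying over `U` and away from the two states. -/
def globInterior {Z : Type*} [TopologicalSpace Z] (U : Set Z) : Set (Glob Z) :=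
  Quot.lift (Sum.elim (fun p => p.1 ∈ U ∧ p.2 ∈ Set.Ioo 0 1) (fun _ => False))
    (by rintro _ _ (z | z) <;> simp)

theorem isOpen_globInterior {Z : Type*} [TopologicalSpace Z] {U : Set Z} (hU : IsOpen U) :
    IsOpen (globInterior U) := by
  refine isOpen_coinduced.2 (isOpen_sum_iff.2 ⟨?_, ?_⟩)
  · exact hU.prod isOpen_Ioo
  · exact isOpen_empty

theorem M11.exists_mem_Ioo (φ : M11) : ∃ t, φ.1 t ∈ Set.Ioo 0 1 := by
  obtain ⟨s, hs⟩ := exists_between (zero_lt_one' unitInterval)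
  obtain ⟨t, rfl⟩ := φ.2.2 s
  exact ⟨t, hs⟩

theorem continuous_globPsi (Z : Type*) [TopologicalSpace Z] :
    Continuous (globPsi (Z := Z)) := by
  refine ContinuousMap.continuous_of_continuous_uncurry _ ?_
  have h : Continuous fun p : (M11 × Z) × unitInterval => p.1.1.1 p.2 :=
    ContinuousEval.continuous_eval.comp
      ((continuous_subtype_val.comp (continuous_fst.comp continuous_fst)).prodMk continuous_snd)
  exact continuous_quot_mk.comp
    (continuous_inl.comp ((continuous_snd.comp continuous_fst).prodMk h))

theorem globPsi_injective (Z : Type*) [TopologicalSpace Z] :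
    Function.Injective (globPsi (Z := Z)) := by
  rintro ⟨φ, z⟩ ⟨ψ, w⟩ h
  obtain ⟨t, ht⟩ := φ.exists_mem_Ioo
  have hmem : globPsi (φ, z) t ∈ globInterior {z} := ⟨rfl, ht⟩
  rw [h] at hmem
  have hw : w = z := hmem.1
  have hφ : φ = ψ := Subtype.ext (congrArg (globHeight Z).comp h)
  rw [hw, hφ]

theorem range_globPsi (Z : Type*) [TopologicalSpace Z] :
    Set.range (globPsi (Z := Z)) = globPaths Z := by
  ext γ
  constructor
  · rintro ⟨⟨φ, z⟩, rfl⟩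
    exact ⟨z, φ.1, φ.2.1, φ.2.2, rfl⟩
  · rintro ⟨z, φ, hm, hs, rfl⟩
    exact ⟨(⟨φ, hm, hs⟩, z), rfl⟩

theorem tendsto_of_tendsto_globPsi {Z ι : Type*} [TopologicalSpace Z] {l : Filter ι}
    {φn : ι → M11} {zn : ι → Z} {φ : M11} {z : Z}
    (h : Filter.Tendsto (fun n => globPsi (φn n, zn n)) l (nhds (globPsi (φ, z)))) :
    Filter.Tendsto zn l (nhds z) ∧ Filter.Tendsto φn l (nhds φ) := by
  constructor
  · obtain ⟨t, ht⟩ := φ.exists_mem_Ioo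
    refine tendsto_nhds.2 fun U hU hz => ?_
    have hev := ((ContinuousEvalConst.continuous_eval_const t).tendsto _).comp h
    filter_upwards [hev.eventually_mem ((isOpen_globInterior hU).mem_nhds ⟨hz, ht⟩)] with n hn
    exact hn.1
  · exact tendsto_subtype_rng.2
      (((ContinuousMap.continuous_postcomp (globHeight Z)).tendsto _).comp h)

/-- `Ψ(φ, z) = δ_z ∘ φ` is continuous and injective with image `P(Z)`, and its inverse is
sequentially continuous: if `δ_{zₙ} ∘ φₙ → δ_z ∘ φ` in the compact-open topology, then
`zₙ → z` in `Z` and `φₙ → φ` uniformly. -/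
theorem stmt8 (Z : Type*) [TopologicalSpace Z] :
    Continuous (globPsi (Z := Z)) ∧
    Function.Injective (globPsi (Z := Z)) ∧
    Set.range (globPsi (Z := Z)) = globPaths Z ∧
    (∀ (φn : ℕ → M11) (zn : ℕ → Z) (φ : M11) (z : Z),
      Filter.Tendsto (fun n => globPsi (φn n, zn n)) Filter.atTop (nhds (globPsi (φ, z))) →
      Filter.Tendsto zn Filter.atTop (nhds z) ∧
        Filter.Tendsto φn Filter.atTop (nhds φ)) :=
  ⟨continuous_globPsi Z, globPsi_injective Z, range_globPsi Z,
    fun _ _ _ _ => tendsto_of_tendsto_globPsi⟩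
end

section
/- Let p ≥ 1 and let Z₁, …, Z_p be nonempty topological spaces; let |X| = |Glob(Z₁) * ⋯ * Glob(Z_p)| be the chain of globes. The map Ψ : M(1, p) × Z₁ × ⋯ × Z_p → C([0,1], |X|) defined by Ψ(φ, z₁, …, z_p) = Γ_{(z₁,…,z_p)} ∘ φ is continuous (with C([0,1], |X|) carrying the compact-open topology) and injective, with image the execution-path set P. Moreover the inverse map P → M(1, p) × Z₁ × ⋯ × Z_p is sequentially continuous: if a sequence (Γ_{z⃗_n} ∘ φ_n) converges to Γ_{z⃗} ∘ φ in the compact-open topology, then φ_n → φ uniformly and, for each 1 ≤ i ≤ p, the i-th components z_n^i converge to z^i in Z_i. -/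
open unitInterval

universe u

/-- The underlying set of the disjoint union `{α₀, …, α_p} ⊔ ⨆_{i} (Z_i × [0,1])` from which
the chain of globes `|Glob(Z₁) * ⋯ * Glob(Z_p)|` is obtained as a quotient. -/
def ChainBase (p : ℕ) (Z : Fin p → Type u) : Type u :=
  (Σ i : Fin p, Z i × unitInterval) ⊕ Fin (p + 1)

instance (p : ℕ) (Z : Fin p → Type u) [∀ i, TopologicalSpace (Z i)] :
    TopologicalSpace (ChainBase p Z) :=
  inferInstanceAs (TopologicalSpace ((Σ i : Fin p, Z i × unitInterval) ⊕ Fin (p + 1)))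

/-- The identifications `(z, 0) ∼ α_{i-1}` and `(z, 1) ∼ α_i` for `z ∈ Z_i`. -/
inductive chainRel (p : ℕ) (Z : Fin p → Type u) : ChainBase p Z → ChainBase p Z → Prop
  | zero (i : Fin p) (z : Z i) :
      chainRel p Z (Sum.inl ⟨i, (z, 0)⟩) (Sum.inr i.castSucc)
  | one (i : Fin p) (z : Z i) :
      chainRel p Z (Sum.inl ⟨i, (z, 1)⟩) (Sum.inr i.succ)

/-- The underlying space `|Glob(Z₁) * ⋯ * Glob(Z_p)|` of the chain of globes,
with the quotient topology. -/
def ChainGlob (p : ℕ) (Z : Fin p → Type u) [∀ i, TopologicalSpace (Z i)] : Type u :=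
  Quot (chainRel p Z)

instance (p : ℕ) (Z : Fin p → Type u) [∀ i, TopologicalSpace (Z i)] :
    TopologicalSpace (ChainGlob p Z) :=
  inferInstanceAs (TopologicalSpace (Quot (chainRel p Z)))

/-- The index `i` (0-based) such that `t ∈ [i, i+1]`, with the convention that the last
interval `[p-1, p]` is closed on the right. -/
noncomputable def chainIdx (p : ℕ) (t : ℝ) : ℕ := min (p - 1) ⌊t⌋₊

lemma chainIdx_lt (p : ℕ) (hp : 0 < p) (t : ℝ) : chainIdx p t < p :=
  lt_of_le_of_lt (min_le_left _ _) (Nat.sub_lt hp Nat.one_pos)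

variable {p : ℕ} {Z : Fin p → Type u} [∀ i, TopologicalSpace (Z i)]

/-- The underlying function of `Γ_{z⃗} : [0, p] → |Glob(Z₁) * ⋯ * Glob(Z_p)|`,
`Γ_{z⃗}(t) = [(z_i, t − i + 1)]` for `t ∈ [i − 1, i]` (1-based indexing). -/
noncomputable def chainGammaFun (hp : 0 < p) (z : ∀ i, Z i) (t : ℝ) : ChainGlob p Z :=
  Quot.mk _ (Sum.inl ⟨⟨chainIdx p t, chainIdx_lt p hp t⟩,
    (z ⟨chainIdx p t, chainIdx_lt p hp t⟩,
     Set.projIcc 0 1 zero_le_one (t - chainIdx p t))⟩)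

lemma chainGammaFun_eq (hp : 0 < p) (z : ∀ i, Z i) (t : ℝ) (j : Fin p)
    (h : chainIdx p t = j.1) :
    chainGammaFun hp z t =
      Quot.mk _ (Sum.inl ⟨j, (z j, Set.projIcc 0 1 zero_le_one (t - j.1))⟩) := by
  obtain ⟨jv, hj⟩ := j
  dsimp at h
  subst h
  rfl

lemma chainGammaFun_continuousOn (hp : 0 < p) (z : ∀ i, Z i) :
    ContinuousOn (chainGammaFun hp z) (Set.Icc (0:ℝ) p) := by
  have hcover : Set.Icc (0:ℝ) p ⊆ ⋃ i : Fin p, Set.Icc (i.1:ℝ) (i.1 + 1) := by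
    intro t ht
    refine Set.mem_iUnion.2 ⟨⟨chainIdx p t, chainIdx_lt p hp t⟩, ?_, ?_⟩
    · calc ((chainIdx p t : ℕ):ℝ) ≤ (⌊t⌋₊ : ℝ) := by
            exact_mod_cast min_le_right _ _
        _ ≤ t := Nat.floor_le ht.1
    · show t ≤ (chainIdx p t : ℝ) + 1
      by_cases hc : ⌊t⌋₊ ≤ p - 1
      · have h1 : chainIdx p t = ⌊t⌋₊ := min_eq_right hc
        rw [h1]
        exact le_of_lt (Nat.lt_floor_add_one t)
      · have h1 : chainIdx p t = p - 1 := min_eq_left (le_of_not_ge hc)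
        have h2 : ((p - 1 : ℕ) : ℝ) + 1 = (p : ℝ) := by
          rw [Nat.cast_sub hp]
          push_cast
          ring
        rw [h1, h2]
        exact ht.2
  refine ContinuousOn.mono ?_ hcover
  refine LocallyFinite.continuousOn_iUnion (locallyFinite_of_finite _)
    (fun i => isClosed_Icc) (fun i => ?_)
  have hgc : Continuous (fun t : ℝ =>
      (Quot.mk (chainRel p Z) (Sum.inl ⟨i, (z i, Set.projIcc 0 1 zero_le_one (t - i.1))⟩) :
        ChainGlob p Z)) :=
    continuous_quot_mk.comp (continuous_inl.comp (continuous_sigmaMk.comp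
      (continuous_const.prodMk
        (continuous_projIcc.comp (continuous_id.sub continuous_const)))))
  refine hgc.continuousOn.congr ?_
  intro t ht
  have ht0 : (0:ℝ) ≤ t := le_trans (by positivity) ht.1
  rcases lt_or_eq_of_le ht.2 with hlt | heq
  · have hfl : ⌊t⌋₊ = i.1 := by
      rw [Nat.floor_eq_iff ht0]
      exact ⟨ht.1, by exact_mod_cast hlt⟩
    have hidx : chainIdx p t = i.1 := by
      unfold chainIdx
      rw [hfl]
      exact min_eq_right (by omega)
    exact chainGammaFun_eq hp z t i hidx
  · subst heq
    by_cases hip : i.1 + 1 < p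
    · have hidx : chainIdx p ((i.1:ℝ) + 1) = (⟨i.1 + 1, hip⟩ : Fin p).1 := by
        unfold chainIdx
        rw [show ((i.1:ℝ) + 1) = ((i.1 + 1 : ℕ) : ℝ) by push_cast; ring, Nat.floor_natCast]
        exact min_eq_right (by omega)
      rw [chainGammaFun_eq hp z _ ⟨i.1 + 1, hip⟩ hidx]
      have e0 : ((i.1:ℝ) + 1) - (((⟨i.1 + 1, hip⟩ : Fin p) : ℕ) : ℝ) = 0 := by
        push_cast
        ring
      have e1 : ((i.1:ℝ) + 1) - (i.1:ℝ) = 1 := by ring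
      show _ = Quot.mk (chainRel p Z)
        (Sum.inl ⟨i, (z i, Set.projIcc 0 1 zero_le_one (((i.1:ℝ) + 1) - i.1))⟩)
      rw [e0, e1, Set.projIcc_left, Set.projIcc_right]
      calc Quot.mk (chainRel p Z)
            (Sum.inl ⟨(⟨i.1 + 1, hip⟩ : Fin p),
              (z ⟨i.1 + 1, hip⟩, ⟨0, Set.left_mem_Icc.2 zero_le_one⟩)⟩)
          = Quot.mk (chainRel p Z) (Sum.inr (Fin.succ i)) :=
            Quot.sound (chainRel.zero ⟨i.1 + 1, hip⟩ (z ⟨i.1 + 1, hip⟩))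
        _ = Quot.mk (chainRel p Z)
              (Sum.inl ⟨i, (z i, ⟨1, Set.right_mem_Icc.2 zero_le_one⟩)⟩) :=
            (Quot.sound (chainRel.one i (z i))).symm
    · have hip' : i.1 + 1 = p := by omega
      have hidx : chainIdx p ((i.1:ℝ) + 1) = i.1 := by
        unfold chainIdx
        rw [show ((i.1:ℝ) + 1) = ((i.1 + 1 : ℕ) : ℝ) by push_cast; ring, Nat.floor_natCast]
        omega
      exact chainGammaFun_eq hp z _ i hidx

/-- The continuous map `Γ_{z⃗} : [0, p] → |Glob(Z₁) * ⋯ * Glob(Z_p)|`,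
`Γ_{z⃗}(t) = [(z_i, t − i + 1)]` for `t ∈ [i − 1, i]`. -/
noncomputable def chainGamma (hp : 0 < p) (z : ∀ i, Z i) :
    C(Set.Icc (0:ℝ) p, ChainGlob p Z) :=
  ⟨Set.restrict _ (chainGammaFun hp z), (chainGammaFun_continuousOn hp z).restrict⟩

/-- The map `Ψ : M(1, p) × (Z₁ × ⋯ × Z_p) → C([0,1], |Glob(Z₁) * ⋯ * Glob(Z_p)|)`,
`Ψ(φ, z⃗) = Γ_{z⃗} ∘ φ`, where `M(1, p)` is the space of continuous nondecreasing
surjective maps `[0,1] → [0,p]`. -/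
noncomputable def chainPsi (hp : 0 < p)
    (q : {φ : C(Set.Icc (0:ℝ) 1, Set.Icc (0:ℝ) p) // Monotone φ ∧ Function.Surjective φ} ×
      (∀ i, Z i)) :
    C(Set.Icc (0:ℝ) 1, ChainGlob p Z) :=
  (chainGamma hp q.2).comp q.1.1

/-- The execution-path set `P = { Γ_{z⃗} ∘ φ : z⃗ ∈ Z₁ × ⋯ × Z_p, φ ∈ M(1, p) }`. -/
def chainPaths (hp : 0 < p) : Set C(Set.Icc (0:ℝ) 1, ChainGlob p Z) :=
  {γ | ∃ (z : ∀ i, Z i) (φ : C(Set.Icc (0:ℝ) 1, Set.Icc (0:ℝ) p)),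
    Monotone φ ∧ Function.Surjective φ ∧ γ = (chainGamma hp z).comp φ}

/-- On `[i, i + 1]`, with both endpoints included, `Γ_{z⃗}` runs through the `i`-th globe. -/
lemma chainGammaFun_eq_of_mem_Icc (hp : 0 < p) (z : ∀ i, Z i) (i : Fin p) {t : ℝ}
    (ht : t ∈ Set.Icc (i.1 : ℝ) (i.1 + 1)) :
    chainGammaFun hp z t =
      Quot.mk _ (Sum.inl ⟨i, (z i, Set.projIcc 0 1 zero_le_one (t - i.1))⟩) := by
  have ht0 : (0 : ℝ) ≤ t := le_trans (by positivity) ht.1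
  rcases ht.2.lt_or_eq with hlt | rfl
  · have hfl : ⌊t⌋₊ = i.1 := (Nat.floor_eq_iff ht0).2 ⟨ht.1, hlt⟩
    refine chainGammaFun_eq hp z t i ?_
    rw [chainIdx, hfl]
    omega
  · have hfl : ⌊(i.1 : ℝ) + 1⌋₊ = i.1 + 1 := by exact_mod_cast Nat.floor_natCast (i.1 + 1)
    by_cases hip : i.1 + 1 < p
    · rw [chainGammaFun_eq hp z _ ⟨i.1 + 1, hip⟩ (by rw [chainIdx, hfl]; simp only; omega)]
      have h0 : (i.1 : ℝ) + 1 - ((i.1 + 1 : ℕ) : ℝ) = 0 := by push_cast; ring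
      simp only [h0, add_sub_cancel_left, Set.projIcc_left, Set.projIcc_right]
      exact (Quot.sound (chainRel.zero ⟨i.1 + 1, hip⟩ (z ⟨i.1 + 1, hip⟩))).trans
        (Quot.sound (chainRel.one i (z i))).symm
    · exact chainGammaFun_eq hp z _ i (by rw [chainIdx, hfl]; omega)

lemma exists_mem_Icc_natCast_add_one (hp : 0 < p) {t : ℝ} (ht : t ∈ Set.Icc (0 : ℝ) p) :
    ∃ i : Fin p, t ∈ Set.Icc (i.1 : ℝ) (i.1 + 1) := by
  rcases ht.2.lt_or_eq with hlt | rfl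
  · exact ⟨⟨⌊t⌋₊, (Nat.floor_lt ht.1).2 hlt⟩, Nat.floor_le ht.1, (Nat.lt_floor_add_one t).le⟩
  · refine ⟨⟨p - 1, by omega⟩, ?_⟩
    simp [Nat.cast_sub (show 1 ≤ p from hp)]

/-- `(z⃗, t) ↦ Γ_{z⃗}(t)` is jointly continuous. -/
lemma continuous_chainGamma_uncurry (hp : 0 < p) :
    Continuous fun q : (∀ i, Z i) × Set.Icc (0 : ℝ) p => chainGamma hp q.1 q.2 := by
  refine (locallyFinite_of_finite fun i : Fin p =>
    {q : (∀ i, Z i) × Set.Icc (0 : ℝ) p | (q.2 : ℝ) ∈ Set.Icc (i.1 : ℝ) (i.1 + 1)}).continuous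
    ?_ (fun i => ?_) (fun i => ?_)
  · refine Set.eq_univ_of_forall fun q => Set.mem_iUnion.2 ?_
    exact exists_mem_Icc_natCast_add_one hp q.2.2
  · exact isClosed_Icc.preimage (continuous_subtype_val.comp continuous_snd)
  · have hc : Continuous fun q : (∀ i, Z i) × Set.Icc (0 : ℝ) p =>
        (Quot.mk (chainRel p Z) (Sum.inl
          ⟨i, (q.1 i, Set.projIcc 0 1 zero_le_one ((q.2 : ℝ) - i.1))⟩) : ChainGlob p Z) :=
      continuous_quot_mk.comp (continuous_inl.comp (continuous_sigmaMk.comp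
        (((continuous_apply i).comp continuous_fst).prodMk (continuous_projIcc.comp
          ((continuous_subtype_val.comp continuous_snd).sub continuous_const)))))
    exact hc.continuousOn.congr fun q hq => chainGammaFun_eq_of_mem_Icc hp q.1 i hq

lemma continuous_chainPsi (hp : 0 < p) : Continuous (chainPsi (Z := Z) hp) := by
  refine ContinuousMap.continuous_of_continuous_uncurry _ ?_
  exact (continuous_chainGamma_uncurry hp).comp
    ((continuous_snd.comp continuous_fst).prodMk
      (continuous_eval.comp
        ((continuous_subtype_val.comp (continuous_fst.comp continuous_fst)).prodMk
          continuous_snd)))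

/-- The height on the disjoint union, sending `(z, t)` in the `i`-th summand to `i + t`. -/
def chainBaseHeight (p : ℕ) (Z : Fin p → Type u) : ChainBase p Z → ℝ :=
  Sum.elim (fun x => x.1.1 + (x.2.2 : ℝ)) (fun j => (j.1 : ℝ))

lemma continuous_chainBaseHeight : Continuous (chainBaseHeight p Z) := by
  refine continuous_sum_dom.2 ⟨continuous_sigma fun i => ?_, continuous_of_discreteTopology⟩
  change Continuous fun a : Z i × I => (i.1 : ℝ) + a.2
  fun_prop

/-- The height `|Glob(Z₁) * ⋯ * Glob(Z_p)| → [0, p]`, a common retraction of the `Γ_{z⃗}`. -/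
noncomputable def chainHeight (p : ℕ) (Z : Fin p → Type u) [∀ i, TopologicalSpace (Z i)] :
    C(ChainGlob p Z, Set.Icc (0 : ℝ) p) where
  toFun x := Set.projIcc 0 (p : ℝ) p.cast_nonneg <| Quot.lift (chainBaseHeight p Z)
    (by rintro _ _ (⟨i, z⟩ | ⟨i, z⟩) <;> simp [chainBaseHeight]) x
  continuous_toFun := continuous_projIcc.comp (continuous_coinduced_dom.2 continuous_chainBaseHeight)

lemma chainHeight_chainGamma (hp : 0 < p) (z : ∀ i, Z i) (t : Set.Icc (0 : ℝ) p) :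
    chainHeight p Z (chainGamma hp z t) = t := by
  obtain ⟨i, hi⟩ := exists_mem_Icc_natCast_add_one hp t.2
  have hmem : (t : ℝ) - i.1 ∈ Set.Icc (0 : ℝ) 1 := ⟨by linarith [hi.1], by linarith [hi.2]⟩
  have hΓ : chainGamma hp z t = _ := chainGammaFun_eq_of_mem_Icc hp z i hi
  rw [hΓ, Set.projIcc_of_mem _ hmem]
  change Set.projIcc 0 (p : ℝ) p.cast_nonneg ((i.1 : ℝ) + ((t : ℝ) - i.1)) = t
  rw [add_sub_cancel, Set.projIcc_val]

lemma chainHeight_comp_chainPsi (hp : 0 < p)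
    (q : {φ : C(Set.Icc (0 : ℝ) 1, Set.Icc (0 : ℝ) p) // Monotone φ ∧ Function.Surjective φ} ×
      (∀ i, Z i)) :
    (chainHeight p Z).comp (chainPsi hp q) = q.1.1 :=
  ContinuousMap.ext fun s => chainHeight_chainGamma hp q.2 (q.1.1 s)

/-- The image in the chain of globes of `W × (0, 1)`, for `W` a subset of `Z i`. -/
def chainCell (i : Fin p) (W : Set (Z i)) : Set (ChainGlob p Z) :=
  {x | Quot.lift
    (Sum.elim (· ∈ Sigma.mk i '' (W ×ˢ Set.Ioo (0 : I) 1)) (fun _ => False) :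
      ChainBase p Z → Prop)
    (by rintro _ _ (⟨j, w⟩ | ⟨j, w⟩) <;> simp +contextual [Sigma.ext_iff] <;> aesop) x}

lemma isOpen_chainCell (i : Fin p) {W : Set (Z i)} (hW : IsOpen W) : IsOpen (chainCell i W) := by
  have hmk : IsOpenMap (Sigma.mk (β := fun j => Z j × I) i) := isOpenMap_sigmaMk
  exact isOpen_coinduced.2 <| isOpen_sum_iff.2
    ⟨hmk _ (hW.prod isOpen_Ioo), isOpen_empty⟩

lemma mk_mem_chainCell_iff (i : Fin p) (W : Set (Z i)) (w : Z i) (t : I) :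
    (Quot.mk _ (Sum.inl ⟨i, (w, t)⟩) : ChainGlob p Z) ∈ chainCell i W ↔
      w ∈ W ∧ t ∈ Set.Ioo (0 : I) 1 := by
  change Sigma.mk (β := fun j => Z j × I) i _ ∈ Sigma.mk i '' (W ×ˢ Set.Ioo (0 : I) 1) ↔ _
  rw [sigma_mk_injective.mem_set_image, Set.mem_prod]

lemma chainGamma_mem_chainCell (hp : 0 < p) (z : ∀ i, Z i) (i : Fin p) {W : Set (Z i)}
    (hz : z i ∈ W) {t : Set.Icc (0 : ℝ) p} (ht : (t : ℝ) ∈ Set.Ioo (i.1 : ℝ) (i.1 + 1)) :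
    chainGamma hp z t ∈ chainCell i W := by
  have hmem : (t : ℝ) - i.1 ∈ Set.Ioo (0 : ℝ) 1 := ⟨by linarith [ht.1], by linarith [ht.2]⟩
  have hΓ : chainGamma hp z t = _ :=
    chainGammaFun_eq_of_mem_Icc hp z i (Set.Ioo_subset_Icc_self ht)
  rw [hΓ, Set.projIcc_of_mem _ (Set.Ioo_subset_Icc_self hmem)]
  exact (mk_mem_chainCell_iff i W _ _).2 ⟨hz, hmem⟩

lemma mem_of_chainGamma_mem_chainCell (hp : 0 < p) (z : ∀ i, Z i) (i : Fin p) {W : Set (Z i)}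
    {t : Set.Icc (0 : ℝ) p} (h : chainGamma hp z t ∈ chainCell i W) : z i ∈ W := by
  obtain ⟨j, hj⟩ := exists_mem_Icc_natCast_add_one hp t.2
  have hΓ : chainGamma hp z t = _ := chainGammaFun_eq_of_mem_Icc hp z j hj
  rw [hΓ] at h
  obtain ⟨_, -, hb⟩ := id h
  obtain rfl : i = j := congrArg Sigma.fst hb
  exact ((mk_mem_chainCell_iff i W _ _).1 h).1

lemma exists_apply_mem_Ioo_natCast (φ : {φ : C(Set.Icc (0 : ℝ) 1, Set.Icc (0 : ℝ) p) //
    Monotone φ ∧ Function.Surjective φ}) (i : Fin p) :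
    ∃ s, (φ.1 s : ℝ) ∈ Set.Ioo (i.1 : ℝ) (i.1 + 1) := by
  have hip : (i.1 : ℝ) + 1 ≤ p := by exact_mod_cast i.2
  obtain ⟨s, hs⟩ := φ.2.2 ⟨i.1 + 1 / 2, by positivity, by linarith⟩
  refine ⟨s, ?_⟩
  rw [hs]
  constructor <;> norm_num

lemma injective_chainPsi (hp : 0 < p) : Function.Injective (chainPsi (Z := Z) hp) := by
  rintro ⟨φ, z⟩ ⟨ψ, w⟩ h
  refine Prod.ext (Subtype.ext ?_) (funext fun i => ?_)
  · rw [← chainHeight_comp_chainPsi hp (φ, z), h, chainHeight_comp_chainPsi]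
  · obtain ⟨s, hs⟩ := exists_apply_mem_Ioo_natCast φ i
    have hmem : chainPsi hp (φ, z) s ∈ chainCell i {z i} :=
      chainGamma_mem_chainCell hp z i (Set.mem_singleton _) hs
    rw [h] at hmem
    exact (mem_of_chainGamma_mem_chainCell hp w i hmem).symm

lemma range_chainPsi (hp : 0 < p) :
    Set.range (chainPsi (Z := Z) hp) = chainPaths (Z := Z) hp := by
  ext γ
  constructor
  · rintro ⟨⟨φ, z⟩, rfl⟩
    exact ⟨z, φ.1, φ.2.1, φ.2.2, rfl⟩
  · rintro ⟨z, φ, hm, hs, rfl⟩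
    exact ⟨(⟨φ, hm, hs⟩, z), rfl⟩

/-- For nonempty spaces `Z₁, …, Z_p` (`p ≥ 1`), the map `Ψ(φ, z⃗) = Γ_{z⃗} ∘ φ` is a
continuous injection onto the execution-path set `P` of the chain of globes
`Glob(Z₁) * ⋯ * Glob(Z_p)`, and its inverse is sequentially continuous: if
`Γ_{z⃗ₙ} ∘ φₙ → Γ_{z⃗} ∘ φ` in the compact-open topology, then `φₙ → φ` uniformly and
`zₙⁱ → zⁱ` in `Z_i` for each `i`. -/
theorem stmt9 (p : ℕ) (hp : 0 < p) (Z : Fin p → Type u) [∀ i, TopologicalSpace (Z i)]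
    (hne : ∀ i, Nonempty (Z i)) :
    Continuous (chainPsi (Z := Z) hp) ∧
    Function.Injective (chainPsi (Z := Z) hp) ∧
    Set.range (chainPsi (Z := Z) hp) = chainPaths (Z := Z) hp ∧
    (∀ (φn : ℕ → {φ : C(Set.Icc (0:ℝ) 1, Set.Icc (0:ℝ) p) //
        Monotone φ ∧ Function.Surjective φ})
      (zn : ℕ → ∀ i, Z i)
      (φ : {φ : C(Set.Icc (0:ℝ) 1, Set.Icc (0:ℝ) p) //
        Monotone φ ∧ Function.Surjective φ})
      (z : ∀ i, Z i),
      Filter.Tendsto (fun n => chainPsi hp (φn n, zn n)) Filter.atTop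
          (nhds (chainPsi hp (φ, z))) →
      Filter.Tendsto φn Filter.atTop (nhds φ) ∧
        ∀ i, Filter.Tendsto (fun n => zn n i) Filter.atTop (nhds (z i))) := by
  refine ⟨continuous_chainPsi hp, injective_chainPsi hp, range_chainPsi hp,
    fun φn zn φ z h => ⟨tendsto_subtype_rng.2 ?_, fun i => ?_⟩⟩
  · simpa only [Function.comp_def, chainHeight_comp_chainPsi] using
      ((chainHeight p Z).continuous_postcomp.tendsto _).comp h
  · obtain ⟨s, hs⟩ := exists_apply_mem_Ioo_natCast φ i
    have hev : Filter.Tendsto (fun n => chainPsi hp (φn n, zn n) s) Filter.atTop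
        (nhds (chainPsi hp (φ, z) s)) :=
      ((continuous_eval_const s).tendsto _).comp h
    refine tendsto_nhds.2 fun W hW hzW => ?_
    filter_upwards [hev ((isOpen_chainCell i hW).mem_nhds
      (chainGamma_mem_chainCell hp z i hzW hs))] with n hn
    exact mem_of_chainGamma_mem_chainCell hp (zn n) i hn
end

section
/- Let p ≥ 1 and n₁, …, n_p ≥ 0, and let |X| = |Glob(D^{n₁}) * ⋯ * Glob(D^{n_p})| be the chain of globes of the closed unit disks D^{n_i} ⊆ ℝ^{n_i} (with D⁰ = {0}). Suppose a sequence (Γ_{z⃗_k} ∘ φ_k)_{k ≥ 0} of elements of the execution-path set P converges pointwise on [0,1] to a continuous map γ : [0,1] → |X|. Then there exist φ ∈ M(1, p) and z⃗ ∈ D^{n₁} × ⋯ × D^{n_p} such that γ = Γ_{z⃗} ∘ φ, and (φ, z⃗) is a cluster point of the sequence ((φ_k, z⃗_k))_{k ≥ 0} in M(1, p) × D^{n₁} × ⋯ × D^{n_p}. In particular, P is sequentially closed in C([0,1], |X|) with the compact-open topology. -/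
open unitInterval

universe u

variable {p : ℕ} {Z : Fin p → Type u} [∀ i, TopologicalSpace (Z i)]

/-- `D^n`, the closed unit disk of `ℝ^n` (with `D⁰ = {0}`). -/
abbrev Disk (n : ℕ) : Type :=
  (Metric.closedBall (0 : EuclideanSpace ℝ (Fin n)) 1 : Set (EuclideanSpace ℝ (Fin n)))

section

open Filter Topology

/-- A sequence of monotone real functions converging pointwise to a continuous function converges
locally uniformly. -/
lemma tendstoLocallyUniformly_of_monotone {ι X : Type*} [TopologicalSpace X] [LinearOrder X]
    [OrderTopology X] {l : Filter ι} {f : ι → X → ℝ} {g : X → ℝ} (hf : ∀ k, Monotone (f k))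
    (hg : Continuous g) (h : ∀ x, Tendsto (fun k => f k x) l (𝓝 (g x))) :
    TendstoLocallyUniformly f g l := by
  rw [Metric.tendstoLocallyUniformly_iff]
  intro ε hε x
  have hU : Metric.ball (g x) (ε / 4) ∈ 𝓝 (g x) := Metric.ball_mem_nhds _ (by positivity)
  obtain ⟨a, b, hx, hab, hsub⟩ := exists_Icc_mem_subset_of_mem_nhds (hg.continuousAt hU)
  have hle : a ≤ b := hx.1.trans hx.2
  refine ⟨_, hab, ?_⟩
  filter_upwards [Metric.tendsto_nhds.1 (h a) (ε / 4) (by positivity),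
    Metric.tendsto_nhds.1 (h b) (ε / 4) (by positivity)] with k hka hkb y hy
  have hga := hsub (Set.left_mem_Icc.2 hle)
  have hgb := hsub (Set.right_mem_Icc.2 hle)
  have hgy := hsub hy
  have h₁ := hf k hy.1
  have h₂ := hf k hy.2
  simp only [Set.mem_preimage, Metric.mem_ball, Real.dist_eq, abs_lt] at *
  constructor <;> linarith

namespace ChainGlob

/-- The height `[(z, t)] ↦ i + t` of a point of a chain of globes. -/
noncomputable def height : ChainGlob p Z → ℝ :=
  Quot.lift (Sum.elim (fun x => (x.1 : ℝ) + x.2.2) (fun j => (j : ℝ))) (by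
    rintro _ _ (⟨i, z⟩ | ⟨i, z⟩) <;> simp)

lemma continuous_height : Continuous (height : ChainGlob p Z → ℝ) := by
  refine continuous_quot_lift _ (Continuous.sumElim ?_ continuous_of_discreteTopology)
  refine continuous_sigma fun i => ?_
  have : Continuous fun x : Z i × unitInterval => (i : ℝ) + x.2 := by fun_prop
  exact this

lemma height_chainGammaFun (hp : 0 < p) (z : ∀ i, Z i) {t : ℝ} (ht : t ∈ Set.Icc (0 : ℝ) p) :
    height (chainGammaFun hp z t) = t := by
  have hle : (chainIdx p t : ℝ) ≤ t :=
    (Nat.cast_le.2 (min_le_right _ _)).trans (Nat.floor_le ht.1)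
  have hlt : t ≤ chainIdx p t + 1 := by
    rcases le_total ⌊t⌋₊ (p - 1) with h | h
    · rw [chainIdx, min_eq_right h]
      exact (Nat.lt_floor_add_one t).le
    · rw [chainIdx, min_eq_left h, Nat.cast_sub hp]
      simpa using ht.2
  change (chainIdx p t : ℝ) + (Set.projIcc (0 : ℝ) 1 zero_le_one (t - chainIdx p t) : ℝ) = t
  rw [Set.projIcc_of_mem zero_le_one ⟨by linarith, by linarith⟩]
  simp

variable {nd : Fin p → ℕ}

/-- The map `[(z, t)] ↦ t (1 - t) z`, valued in the `i`-th summand of `⨁ᵢ ℝ^{nᵢ}` on the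
`i`-th globe. -/
noncomputable def bump :
    ChainGlob p (fun i => Disk (nd i)) → ∀ i, EuclideanSpace ℝ (Fin (nd i)) :=
  Quot.lift (Sum.elim (fun x => Pi.single x.1
    (((x.2.2 : ℝ) * (1 - x.2.2)) • (x.2.1 : EuclideanSpace ℝ (Fin (nd x.1))))) (fun _ => 0)) (by
    rintro _ _ (⟨i, z⟩ | ⟨i, z⟩) <;> simp)

lemma continuous_bump : Continuous (bump (nd := nd)) := by
  refine continuous_quot_lift _ (Continuous.sumElim ?_ continuous_of_discreteTopology)
  refine continuous_sigma fun i => (continuous_single i).comp ?_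
  have : Continuous fun x : Disk (nd i) × unitInterval =>
      ((x.2 : ℝ) * (1 - x.2)) • (x.1 : EuclideanSpace ℝ (Fin (nd i))) := by fun_prop
  exact this

lemma bump_chainGammaFun (hp : 0 < p) (z : ∀ i, Disk (nd i)) {t : ℝ}
    (ht : t ∈ Set.Icc (0 : ℝ) p) (i : Fin p) :
    bump (chainGammaFun hp z t) i =
      ((Set.projIcc (0 : ℝ) 1 zero_le_one (t - i) : ℝ) *
        (1 - Set.projIcc (0 : ℝ) 1 zero_le_one (t - i))) •
        (z i : EuclideanSpace ℝ (Fin (nd i))) := by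
  by_cases hi : chainIdx p t = i
  · rw [chainGammaFun_eq hp z t i hi]
    exact Pi.single_eq_same (M := fun i => EuclideanSpace ℝ (Fin (nd i))) i _
  · have hzero : bump (chainGammaFun hp z t) i = 0 :=
      Pi.single_eq_of_ne (M := fun i => EuclideanSpace ℝ (Fin (nd i)))
        (fun h => hi (by rw [h])) _
    rw [hzero]
    rcases lt_or_ge t i with h | h
    · rw [Set.projIcc_of_le_left _ (by linarith)]
      simp
    · have h₁ : (i : ℝ) + 1 ≤ t := by
        by_contra! h₁
        have hfl : ⌊t⌋₊ = i := (Nat.floor_eq_iff ht.1).2 ⟨h, h₁⟩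
        exact hi (by rw [chainIdx, hfl]; omega)
      rw [Set.projIcc_of_right_le _ (by linarith)]
      simp

lemma eq_vertex_or_interior (x : ChainGlob p Z) :
    (∃ j, x = Quot.mk _ (Sum.inr j)) ∨
      ∃ (i : Fin p) (z : Z i) (t : unitInterval), 0 < (t : ℝ) ∧ (t : ℝ) < 1 ∧
        x = Quot.mk _ (Sum.inl ⟨i, (z, t)⟩) := by
  obtain ⟨⟨i, z, t⟩ | j, rfl⟩ := Quot.exists_rep x
  · rcases t.2.1.eq_or_lt with h₀ | h₀
    · obtain rfl : t = 0 := Subtype.ext h₀.symm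
      exact .inl ⟨_, Quot.sound (.zero i z)⟩
    rcases t.2.2.eq_or_lt with h₁ | h₁
    · obtain rfl : t = 1 := Subtype.ext h₁
      exact .inl ⟨_, Quot.sound (.one i z)⟩
    exact .inr ⟨i, z, t, h₀, h₁, rfl⟩
  · exact .inl ⟨j, rfl⟩

lemma natCast_ne_natCast_add {m n : ℕ} {t : ℝ} (h₀ : 0 < t) (h₁ : t < 1) : (m : ℝ) ≠ n + t := by
  intro h
  have h₂ : n < m := by exact_mod_cast (by linarith : (n : ℝ) < m)
  have h₃ : m < n + 1 := by exact_mod_cast (by linarith : (m : ℝ) < n + 1)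
  omega

/-- The height and the bump map jointly separate the points of a chain of globes of disks. -/
lemma ext_height_bump {x y : ChainGlob p (fun i => Disk (nd i))} (hh : height x = height y)
    (hb : bump x = bump y) : x = y := by
  rcases eq_vertex_or_interior x with ⟨j, rfl⟩ | ⟨i, z, t, ht₀, ht₁, rfl⟩ <;>
    rcases eq_vertex_or_interior y with ⟨k, rfl⟩ | ⟨l, w, s, hs₀, hs₁, rfl⟩
  · have hjk : (j : ℝ) = k := hh
    rw [Fin.ext (Nat.cast_injective hjk)]
  · exact (natCast_ne_natCast_add hs₀ hs₁ hh).elim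
  · exact (natCast_ne_natCast_add ht₀ ht₁ hh.symm).elim
  · have hts : (i : ℝ) + t = l + s := hh
    have h₁ : (i : ℕ) < l + 1 := by exact_mod_cast (by linarith : (i : ℝ) < l + 1)
    have h₂ : (l : ℕ) < i + 1 := by exact_mod_cast (by linarith : (l : ℝ) < i + 1)
    obtain rfl : i = l := Fin.ext (by omega)
    obtain rfl : t = s := Subtype.ext (by linarith)
    have hzw : ((t : ℝ) * (1 - t)) • (z : EuclideanSpace ℝ (Fin (nd i))) =
        ((t : ℝ) * (1 - t)) • (w : EuclideanSpace ℝ (Fin (nd i))) :=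
      Pi.single_injective (M := fun i => EuclideanSpace ℝ (Fin (nd i))) i hb
    have hne : (t : ℝ) * (1 - t) ≠ 0 := (mul_pos ht₀ (sub_pos.2 ht₁)).ne'
    rw [Subtype.ext (smul_right_injective _ hne hzw)]

end ChainGlob

open ChainGlob

/-- If execution paths `Γ_{z⃗ₖ} ∘ φₖ` converge pointwise to `γ`, then the reparametrizations `φₖ`
converge in `M(1, p)` to a map which gives the height of `γ`. -/
lemma exists_tendsto_reparametrization (hp : 0 < p)
    {φk : ℕ → {φ : C(Set.Icc (0:ℝ) 1, Set.Icc (0:ℝ) p) // Monotone φ ∧ Function.Surjective φ}}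
    {zk : ℕ → ∀ i, Z i} {γ : C(Set.Icc (0:ℝ) 1, ChainGlob p Z)}
    (h : ∀ t, Tendsto (fun k => chainPsi hp (φk k, zk k) t) atTop (𝓝 (γ t))) :
    ∃ φ : {φ : C(Set.Icc (0:ℝ) 1, Set.Icc (0:ℝ) p) // Monotone φ ∧ Function.Surjective φ},
      (∀ t, height (γ t) = φ.1 t) ∧ Tendsto φk atTop (𝓝 φ) := by
  have hlim (t) : Tendsto (fun k => ((φk k).1 t : ℝ)) atTop (𝓝 (height (γ t))) := by
    refine ((continuous_height.tendsto _).comp (h t)).congr fun k => ?_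
    exact height_chainGammaFun hp (zk k) ((φk k).1 t).2
  have hmem (t) : height (γ t) ∈ Set.Icc (0:ℝ) p :=
    isClosed_Icc.mem_of_tendsto (hlim t) (.of_forall fun k => ((φk k).1 t).2)
  have hcont : Continuous fun t => height (γ t) := continuous_height.comp γ.continuous
  have hmono : Monotone fun t => height (γ t) := fun s t hst =>
    le_of_tendsto_of_tendsto' (hlim s) (hlim t) fun k => (φk k).2.1 hst
  have hbot : height (γ ⊥) = 0 := tendsto_nhds_unique (hlim ⊥) <|
    tendsto_const_nhds.congr fun k => by
      obtain ⟨s, hs⟩ := (φk k).2.2 ⟨0, le_rfl, Nat.cast_nonneg p⟩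
      exact le_antisymm ((φk k).1 ⊥).2.1 (((φk k).2.1 (bot_le : ⊥ ≤ s)).trans_eq hs)
  have htop : height (γ ⊤) = p := tendsto_nhds_unique (hlim ⊤) <|
    tendsto_const_nhds.congr fun k => by
      obtain ⟨s, hs⟩ := (φk k).2.2 ⟨p, Nat.cast_nonneg p, le_rfl⟩
      exact le_antisymm (hs.symm.trans_le ((φk k).2.1 (le_top : s ≤ ⊤))) ((φk k).1 ⊤).2.2
  refine ⟨⟨⟨fun t => ⟨height (γ t), hmem t⟩, hcont.subtype_mk _⟩, fun s t hst => hmono hst,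
    fun y => ?_⟩, fun t => rfl, ?_⟩
  · obtain ⟨t, ht⟩ := mem_range_of_exists_le_of_exists_ge hcont
      ⟨⊥, hbot.trans_le y.2.1⟩ ⟨⊤, y.2.2.trans_eq htop.symm⟩
    exact ⟨t, Subtype.ext ht⟩
  · rw [tendsto_subtype_rng, ContinuousMap.tendsto_iff_tendstoLocallyUniformly]
    have := tendstoLocallyUniformly_of_monotone (f := fun k t => ((φk k).1 t : ℝ))
      (fun k s t hst => (φk k).2.1 hst) hcont hlim
    rw [Metric.tendstoLocallyUniformly_iff] at this ⊢
    exact this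

end

/-- In the chain of globes `Glob(D^{n₁}) * ⋯ * Glob(D^{n_p})` of closed unit disks
(`p ≥ 1`): if a sequence `(Γ_{z⃗ₖ} ∘ φₖ)` of execution paths converges pointwise on `[0,1]`
to a continuous map `γ`, then `γ = Γ_{z⃗} ∘ φ` for some `φ ∈ M(1,p)` and `z⃗`, where
`(φ, z⃗)` is a cluster point of the sequence `((φₖ, z⃗ₖ))`; in particular, the
execution-path set `P` is sequentially closed in `C([0,1], |X|)` with the compact-open
topology. -/
theorem stmt10 (p : ℕ) (hp : 0 < p) (nd : Fin p → ℕ) :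
    (∀ (φk : ℕ → {φ : C(Set.Icc (0:ℝ) 1, Set.Icc (0:ℝ) p) //
        Monotone φ ∧ Function.Surjective φ})
      (zk : ℕ → ∀ i, Disk (nd i))
      (γ : C(Set.Icc (0:ℝ) 1, ChainGlob p (fun i => Disk (nd i)))),
      (∀ t, Filter.Tendsto (fun k => chainPsi hp (φk k, zk k) t) Filter.atTop (nhds (γ t))) →
      ∃ (φ : {φ : C(Set.Icc (0:ℝ) 1, Set.Icc (0:ℝ) p) //
          Monotone φ ∧ Function.Surjective φ})
        (z : ∀ i, Disk (nd i)),
        γ = chainPsi hp (φ, z) ∧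
        MapClusterPt (φ, z) Filter.atTop (fun k => (φk k, zk k))) ∧
    (∀ (γk : ℕ → C(Set.Icc (0:ℝ) 1, ChainGlob p (fun i => Disk (nd i))))
      (γlim : C(Set.Icc (0:ℝ) 1, ChainGlob p (fun i => Disk (nd i)))),
      (∀ k, γk k ∈ chainPaths (Z := fun i => Disk (nd i)) hp) →
      Filter.Tendsto γk Filter.atTop (nhds γlim) →
      γlim ∈ chainPaths (Z := fun i => Disk (nd i)) hp) := by
  refine and_iff_left_of_imp ?_ |>.2 ?_
  · intro h γk γlim hγk hlim
    choose zk φk hmono hsurj hγ using hγk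
    obtain ⟨φ, z, hφz, -⟩ := h (fun k => ⟨φk k, hmono k, hsurj k⟩) zk γlim fun t => by
      refine (((continuous_eval_const t).tendsto γlim).comp hlim).congr fun k => ?_
      exact congrArg (fun f => f t) (hγ k)
    exact ⟨z, φ.1, φ.2.1, φ.2.2, hφz⟩
  · intro φk zk γ h
    obtain ⟨φ, hφ, hφk⟩ := exists_tendsto_reparametrization hp h
    obtain ⟨z, ψ, hψ, hz⟩ := CompactSpace.tendsto_subseq zk
    have hψ' := hψ.tendsto_atTop
    refine ⟨φ, z, ?_, .of_comp hψ' ((hφk.comp hψ').prodMk_nhds hz).mapClusterPt⟩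
    ext1 t
    refine ChainGlob.ext_height_bump ?_ (funext fun i => ?_)
    · exact (hφ t).trans (ChainGlob.height_chainGammaFun hp z (φ.1 t).2).symm
    · refine tendsto_nhds_unique (((continuous_apply i).comp
        ChainGlob.continuous_bump).continuousAt.tendsto.comp ((h t).comp hψ')) ?_
      have hφt : Filter.Tendsto (fun k => ((φk (ψ k)).1 t : ℝ)) Filter.atTop
          (nhds (φ.1 t : ℝ)) := by
        have hc : Continuous fun f : {φ : C(Set.Icc (0:ℝ) 1, Set.Icc (0:ℝ) p) //
            Monotone φ ∧ Function.Surjective φ} => (f.1 t : ℝ) := by fun_prop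
        exact (hc.tendsto φ).comp (hφk.comp hψ')
      have hzi : Filter.Tendsto (fun k => (zk (ψ k) i : EuclideanSpace ℝ (Fin (nd i))))
          Filter.atTop (nhds (z i : EuclideanSpace ℝ (Fin (nd i)))) := by
        have hc : Continuous fun w : ∀ i, Disk (nd i) =>
            (w i : EuclideanSpace ℝ (Fin (nd i))) := by fun_prop
        exact (hc.tendsto z).comp hz
      have hw : Continuous fun s : ℝ => (Set.projIcc (0 : ℝ) 1 zero_le_one (s - i) : ℝ) *
          (1 - Set.projIcc (0 : ℝ) 1 zero_le_one (s - i)) := by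
        have : Continuous fun s : ℝ => (Set.projIcc (0 : ℝ) 1 zero_le_one (s - i) : ℝ) :=
          continuous_subtype_val.comp
            (continuous_projIcc.comp (continuous_id.sub continuous_const))
        fun_prop
      have hlim := ((hw.tendsto _).comp hφt).smul hzi
      rw [← ChainGlob.bump_chainGammaFun hp z (φ.1 t).2 i] at hlim
      exact hlim.congr fun k =>
        (ChainGlob.bump_chainGammaFun hp (zk (ψ k)) ((φk (ψ k)).1 t).2 i).symm
end
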